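/- arXiv:1208.3075 — 3 statements merged into one kernel-verified Lean document; each statement's English description precedes it below -/
import Mathlib

section
/- Let a finitely generated group G be the free product of non-identity groups A and B. If φ is an injective but not surjective endomorphism of G such that Aφ ⊆ A and Bφ ⊆ B, then the descending HNN-extension G(φ) = ⟨G, t ; t⁻¹gt = gφ (g ∈ G)⟩ does not have the Howson property. -/
/-- A group has the Howson property if the intersection of any two finitely
generated subgroups is finitely generated. -/
def HowsonGroup (G : Type*) [Group G] : Prop :=
  ∀ H K : Subgroup G, H.FG → K.FG → (H ⊓ K).FG

/-- The descending HNN-extension `G(φ) = ⟨G, t ; t⁻¹ g t = gφ (g ∈ G)⟩` of a group `G`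
with respect to an injective endomorphism `φ`, realized as the Mathlib `HNNExtension`
with base `G`, associated subgroups `φ.range` and `G` (i.e. `⊤`), so that the relation
`t⁻¹ * of g * t = of (φ g)` holds for all `g : G`. -/
abbrev DescHNN {G : Type*} [Group G] (φ : G →* G) (hφ : Function.Injective φ) : Type _ :=
  HNNExtension G (MonoidHom.range φ) ⊤
    ((MonoidHom.ofInjective hφ).symm.trans Subgroup.topEquiv.symm)

/-- The subgroup generated by subgroups `H` and `K` of a group `G` is their internal
free product `H ∗ K`: the canonical homomorphism from the abstract free product
`H ∗ K` to `G` (whose range is `⟨H, K⟩ = H ⊔ K`) is injective. -/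
def IsInternalFreeProductPair {G : Type*} [Group G] (H K : Subgroup G) : Prop :=
  Function.Injective (Monoid.Coprod.lift H.subtype K.subtype)

/-- A subgroup `H` of a group `G` is freely complemented if there is a non-identity
subgroup `K` of `G` such that the subgroup generated by `H` and `K` is their
internal free product `H ∗ K`. -/
def FreelyComplemented {G : Type*} [Group G] (H : Subgroup G) : Prop :=
  ∃ K : Subgroup G, K ≠ ⊥ ∧ IsInternalFreeProductPair H K

section FreeProductAction

universe u

variable {G : Type u} [Group G]

/-- Swapping the factors of an internal free product. -/
theorem IsInternalFreeProductPair.symm {A B : Subgroup G} (h : IsInternalFreeProductPair A B) :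
    IsInternalFreeProductPair B A := by
  unfold IsInternalFreeProductPair at h ⊢
  rw [← Monoid.Coprod.lift_comp_swap, MonoidHom.coe_comp]
  exact h.comp Monoid.Coprod.swap_injective

/-- Homomorphisms out of an internal free product may be prescribed on the two factors. -/
theorem IsInternalFreeProductPair.exists_hom {A B : Subgroup G}
    (h : IsInternalFreeProductPair A B) (hgen : A ⊔ B = ⊤) {P : Type*} [Group P]
    (f : A →* P) (g : B →* P) :
    ∃ ρ : G →* P, (∀ a : A, ρ a = f a) ∧ ∀ b : B, ρ b = g b := by
  have hsurj : Function.Surjective (Monoid.Coprod.lift A.subtype B.subtype) := by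
    rw [← MonoidHom.range_eq_top, Monoid.Coprod.range_lift, Subgroup.range_subtype,
      Subgroup.range_subtype, hgen]
  let e := MulEquiv.ofBijective (Monoid.Coprod.lift A.subtype B.subtype) ⟨h, hsurj⟩
  refine ⟨(Monoid.Coprod.lift f g).comp e.symm.toMonoidHom, fun a => ?_, fun b => ?_⟩
  · have : e.symm (a : G) = Monoid.Coprod.inl a := by
      rw [MulEquiv.symm_apply_eq]
      exact (Monoid.Coprod.lift_apply_inl A.subtype B.subtype a).symm
    simp [this]
  · have : e.symm (b : G) = Monoid.Coprod.inr b := by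
      rw [MulEquiv.symm_apply_eq]
      exact (Monoid.Coprod.lift_apply_inr A.subtype B.subtype b).symm
    simp [this]

open Classical in
/-- A subgroup `B` acts on `G × X` by left multiplication on the fibre over `x₀`, and trivially
on the other fibres. -/
noncomputable def fiberPermHom (B : Subgroup G) {X : Type*} (x₀ : X) :
    B →* Equiv.Perm (G × X) :=
  MonoidHom.toHomPerm
    { toFun := fun b p => if p.2 = x₀ then (b * p.1, p.2) else p
      map_one' := by
        funext p
        simp [Function.End.one_def]
      map_mul' := fun b c => by
        funext p
        change _ = ite _ _ _
        by_cases hp : p.2 = x₀ <;> simp [hp, mul_assoc] }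

theorem fiberPermHom_apply_self (B : Subgroup G) {X : Type*} (x₀ : X) (b : B) (g : G) :
    fiberPermHom B x₀ b (g, x₀) = ((b : G) * g, x₀) :=
  if_pos rfl

theorem fiberPermHom_apply_of_ne (B : Subgroup G) {X : Type*} {x₀ x : X} (hx : x ≠ x₀) (b : B)
    (g : G) : fiberPermHom B x₀ b (g, x) = (g, x) :=
  if_neg hx

/-- In a free product `G = A ∗ B` with `C ≤ A`, `a ∈ A \ C` and `b ∈ B`, the group `G` acts on some
set containing a copy of `G` on which `C` and `B` act by left multiplication while `a * b * a⁻¹`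
acts trivially. -/
theorem IsInternalFreeProductPair.exists_action {A B : Subgroup G}
    (h : IsInternalFreeProductPair A B) (hgen : A ⊔ B = ⊤) {C : Subgroup G} (hC : C ≤ A)
    {a b : G} (ha : a ∈ A) (haC : a ∉ C) (hb : b ∈ B) :
    ∃ (Y : Type u) (ρ : G →* Equiv.Perm Y) (i : G → Y), Function.Injective i ∧
      (∀ g ∈ C ⊔ B, ∀ x, ρ g (i x) = i (g * x)) ∧ ∀ x, ρ (a * b * a⁻¹) (i x) = i x := by
  let C' : Subgroup A := C.subgroupOf A
  let x₀ : A ⧸ C' := ((1 : A) : A ⧸ C')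
  obtain ⟨ρ, hρA, hρB⟩ := h.exists_hom hgen (MulAction.toPermHom A (G × A ⧸ C'))
    (fiberPermHom B x₀)
  refine ⟨G × A ⧸ C', ρ, fun x => (x, x₀), fun x y hxy => congrArg Prod.fst hxy, ?_, ?_⟩
  · let S : Subgroup G :=
      { carrier := {g | ∀ x, ρ g (x, x₀) = (g * x, x₀)}
        one_mem' := fun x => by simp
        mul_mem' := fun {g k} hg hk x => by
          rw [map_mul, Equiv.Perm.mul_apply, hk, hg, mul_assoc]
        inv_mem' := fun {g} hg x => by
          rw [map_inv, Equiv.Perm.inv_eq_iff_eq, hg, mul_inv_cancel_left] }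
    suffices hS : C ⊔ B ≤ S from fun g hg => hS hg
    refine sup_le (fun c hc x => ?_) fun b hb x => ?_
    · have hx₀ : (⟨c, hC hc⟩ : A) • x₀ = x₀ := by
        change (((⟨c, hC hc⟩ : A) * 1 : A) : A ⧸ C') = ((1 : A) : A ⧸ C')
        rw [mul_one, eq_comm, QuotientGroup.eq]
        simpa [C', Subgroup.mem_subgroupOf] using hc
      rw [hρA ⟨c, hC hc⟩, MulAction.toPermHom_apply, MulAction.toPerm_apply, Prod.smul_mk, hx₀]
      rfl
    · rw [hρB ⟨b, hb⟩, fiberPermHom_apply_self]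
  · intro x
    have hne : (⟨a, ha⟩ : A)⁻¹ • x₀ ≠ x₀ := by
      change (((⟨a, ha⟩ : A)⁻¹ * 1 : A) : A ⧸ C') ≠ ((1 : A) : A ⧸ C')
      rw [mul_one, Ne, QuotientGroup.eq]
      simpa [C', Subgroup.mem_subgroupOf] using haC
    have hρa : ρ a = MulAction.toPermHom A (G × A ⧸ C') ⟨a, ha⟩ := hρA ⟨a, ha⟩
    rw [map_mul, map_mul, map_inv, Equiv.Perm.mul_apply, Equiv.Perm.mul_apply, hρa, ← map_inv,
      hρB ⟨b, hb⟩, MulAction.toPermHom_apply, MulAction.toPermHom_apply, MulAction.toPerm_apply,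
      MulAction.toPerm_apply]
    change _ • fiberPermHom B x₀ _ (_ • x, _ • x₀) = _
    rw [fiberPermHom_apply_of_ne _ hne, ← Prod.smul_mk, smul_inv_smul]

/-- If `G` acts on a set containing a copy of `G`, such that `D` acts on this copy by left
multiplication and `k` acts trivially, then `⟨P, k⟩ ∩ D ≤ P` for all `P ≤ D`. -/
theorem mem_of_mem_sup_zpowers_of_action {Y : Type*} (ρ : G →* Equiv.Perm Y) {i : G → Y}
    (hi : Function.Injective i) {D : Subgroup G} {k : G}
    (hD : ∀ g ∈ D, ∀ x, ρ g (i x) = i (g * x)) (hk : ∀ x, ρ k (i x) = i x)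
    {P : Subgroup G} (hP : P ≤ D) {x : G} (hx : x ∈ P ⊔ Subgroup.zpowers k) (hxD : x ∈ D) :
    x ∈ P := by
  let S : Subgroup G :=
    { carrier := {g | ∀ y, (∃ p ∈ P, i p = ρ g y) ↔ ∃ p ∈ P, i p = y}
      one_mem' := fun y => by simp
      mul_mem' := fun {g l} hg hl y => by
        rw [map_mul, Equiv.Perm.mul_apply, hg, hl]
      inv_mem' := fun {g} hg y => by
        rw [← hg, ← Equiv.Perm.mul_apply, ← map_mul, mul_inv_cancel, map_one,
          Equiv.Perm.one_apply] }
  have hS : P ⊔ Subgroup.zpowers k ≤ S := by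
    refine sup_le (fun g hg y => ⟨?_, ?_⟩) (Subgroup.zpowers_le.2 fun y => ⟨?_, ?_⟩)
    · rintro ⟨p, hp, h⟩
      refine ⟨g⁻¹ * p, mul_mem (inv_mem hg) hp, (ρ g).injective ?_⟩
      rw [hD g (hP hg), mul_inv_cancel_left, h]
    · rintro ⟨p, hp, rfl⟩
      exact ⟨g * p, mul_mem hg hp, (hD g (hP hg) p).symm⟩
    · rintro ⟨p, hp, h⟩
      exact ⟨p, hp, (ρ k).injective (by rw [hk, h])⟩
    · rintro ⟨p, hp, rfl⟩
      exact ⟨p, hp, (hk p).symm⟩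
  obtain ⟨p, hp, h⟩ := (hS hx (i 1)).2 ⟨1, one_mem P, rfl⟩
  rw [hD x hxD, mul_one] at h
  exact hi h ▸ hp

end FreeProductAction

section OrbitSubgroup

variable {G : Type*} [Group G] (φ : G →* G) (k : G)

/-- The subgroup generated by the first `n` elements of the sequence `k, φ k, φ (φ k), …`. -/
def iterateSubgroup : ℕ → Subgroup G
  | 0 => ⊥
  | n + 1 => (iterateSubgroup n).map φ ⊔ Subgroup.zpowers k

/-- The subgroup generated by all the elements `k, φ k, φ (φ k), …`. -/
def orbitSubgroup : Subgroup G := ⨆ n, iterateSubgroup φ k n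

theorem iterateSubgroup_le_succ (n : ℕ) :
    iterateSubgroup φ k n ≤ iterateSubgroup φ k (n + 1) := by
  induction n with
  | zero => exact bot_le
  | succ n ih => exact sup_le_sup_right (Subgroup.map_mono ih) _

theorem iterateSubgroup_mono : Monotone (iterateSubgroup φ k) :=
  monotone_nat_of_le_succ (iterateSubgroup_le_succ φ k)

theorem mem_orbitSubgroup_iff {x : G} :
    x ∈ orbitSubgroup φ k ↔ ∃ n, x ∈ iterateSubgroup φ k n :=
  Subgroup.mem_iSup_of_directed (iterateSubgroup_mono φ k).directed_le

theorem map_mem_orbitSubgroup {x : G} (hx : x ∈ orbitSubgroup φ k) :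
    φ x ∈ orbitSubgroup φ k := by
  obtain ⟨n, hn⟩ := (mem_orbitSubgroup_iff φ k).1 hx
  exact (mem_orbitSubgroup_iff φ k).2 ⟨n + 1, Subgroup.mem_sup_left (Subgroup.mem_map_of_mem φ hn)⟩

theorem self_mem_orbitSubgroup : k ∈ orbitSubgroup φ k :=
  (mem_orbitSubgroup_iff φ k).2 ⟨1, Subgroup.mem_sup_right (Subgroup.mem_zpowers k)⟩

theorem iterate_mem_orbitSubgroup {x : G} (hx : x ∈ orbitSubgroup φ k) (n : ℕ) :
    φ^[n] x ∈ orbitSubgroup φ k := by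
  induction n with
  | zero => exact hx
  | succ n ih =>
    rw [Function.iterate_succ_apply']
    exact map_mem_orbitSubgroup φ k ih

variable {φ k}

theorem orbitSubgroup_le : orbitSubgroup φ k ≤ (orbitSubgroup φ k).map φ ⊔ Subgroup.zpowers k := by
  refine iSup_le fun n => ?_
  cases n with
  | zero => exact bot_le
  | succ n => exact sup_le_sup_right (Subgroup.map_mono (le_iSup _ n)) _

/-- `⟨P, k⟩` meets `φ G` only in `P`, for every subgroup `P ≤ φ G`. This holds when `φ G` and `k`
generate the free product `φ G ∗ ⟨k⟩`. -/
def SplitsOff (φ : G →* G) (k : G) : Prop :=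
  ∀ P ≤ φ.range, ∀ x ∈ P ⊔ Subgroup.zpowers k, x ∈ φ.range → x ∈ P

theorem SplitsOff.mem_of_map_mem (h : SplitsOff φ k) (hφ : Function.Injective φ) {P : Subgroup G}
    {x : G} (hx : φ x ∈ P.map φ ⊔ Subgroup.zpowers k) : x ∈ P := by
  have := h _ (Subgroup.map_le_range φ P) _ hx ⟨x, rfl⟩
  rwa [Subgroup.mem_map_iff_mem hφ] at this

theorem SplitsOff.mem_orbitSubgroup_of_iterate_mem (h : SplitsOff φ k)
    (hφ : Function.Injective φ) {x : G} {n : ℕ} (hx : φ^[n] x ∈ orbitSubgroup φ k) :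
    x ∈ orbitSubgroup φ k := by
  induction n with
  | zero => exact hx
  | succ n ih =>
    rw [Function.iterate_succ_apply'] at hx
    exact ih (h.mem_of_map_mem hφ (orbitSubgroup_le hx))

theorem SplitsOff.iterate_notMem (h : SplitsOff φ k) (hφ : Function.Injective φ) (hk : k ≠ 1)
    (n : ℕ) : φ^[n] k ∉ iterateSubgroup φ k n := by
  induction n with
  | zero => simpa [iterateSubgroup] using hk
  | succ n ih =>
    rw [Function.iterate_succ_apply']
    exact fun hmem => ih (h.mem_of_map_mem hφ hmem)

theorem SplitsOff.not_fg_orbitSubgroup (h : SplitsOff φ k) (hφ : Function.Injective φ)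
    (hk : k ≠ 1) : ¬ (orbitSubgroup φ k).FG := by
  rintro ⟨S, hS⟩
  have hex : ∀ s : S, ∃ n, (s : G) ∈ iterateSubgroup φ k n := fun s =>
    (mem_orbitSubgroup_iff φ k).1 (hS ▸ Subgroup.subset_closure s.2)
  choose f hf using hex
  let N := Finset.univ.sup f
  have hle : orbitSubgroup φ k ≤ iterateSubgroup φ k N := by
    rw [← hS, Subgroup.closure_le]
    exact fun s hs => iterateSubgroup_mono φ k (Finset.le_sup (Finset.mem_univ ⟨s, hs⟩)) (hf ⟨s, hs⟩)
  exact h.iterate_notMem hφ hk N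
    (hle (iterate_mem_orbitSubgroup φ k (self_mem_orbitSubgroup φ k) N))

end OrbitSubgroup

namespace DescHNN

open HNNExtension

variable {G : Type*} [Group G] {φ : G →* G} {hφ : Function.Injective φ}

theorem of_mul_t (g : G) : (of g * t : DescHNN φ hφ) = t * of (φ g) := by
  have := HNNExtension.of_mul_t (φ := (MonoidHom.ofInjective hφ).symm.trans Subgroup.topEquiv.symm)
    ⟨g, Subgroup.mem_top g⟩
  exact this

theorem of_mul_t_pow (g : G) (n : ℕ) : (of g * t ^ n : DescHNN φ hφ) = t ^ n * of (φ^[n] g) := by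
  induction n with
  | zero => simp
  | succ n ih =>
    rw [pow_succ, ← mul_assoc, ih, mul_assoc, of_mul_t, Function.iterate_succ_apply', mul_assoc]

/-- The exponent sum of the stable letter. -/
noncomputable def degree (φ : G →* G) (hφ : Function.Injective φ) :
    DescHNN φ hφ →* Multiplicative ℤ :=
  lift 1 (Multiplicative.ofAdd 1) (by simp)

theorem exists_of_mem_closure {k : G} {x : DescHNN φ hφ}
    (hx : x ∈ Subgroup.closure {t, of k}) :
    ∃ (i j : ℕ) (l : G), l ∈ orbitSubgroup φ k ∧ x * t ^ j = t ^ i * of l := by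
  have hof : ∀ m ∈ orbitSubgroup φ k, ∀ y : DescHNN φ hφ,
      (∃ (i j : ℕ) (l : G), l ∈ orbitSubgroup φ k ∧ y * t ^ j = t ^ i * of l) →
      ∃ (i j : ℕ) (l : G), l ∈ orbitSubgroup φ k ∧ y * of m * t ^ j = t ^ i * of l := by
    rintro m hm y ⟨i, j, l, hl, h⟩
    refine ⟨i, j, l * φ^[j] m, mul_mem hl (iterate_mem_orbitSubgroup φ k hm j), ?_⟩
    rw [mul_assoc, of_mul_t_pow, ← mul_assoc, h, map_mul, mul_assoc]
  have hk := self_mem_orbitSubgroup φ k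
  induction hx using Subgroup.closure_induction_right with
  | one => exact ⟨0, 0, 1, one_mem _, by simp⟩
  | mul_right y hy s hs ih =>
    rcases hs with rfl | rfl
    · obtain ⟨i, j, l, hl, h⟩ := ih
      refine ⟨i + 1, j, φ l, map_mem_orbitSubgroup φ k hl, ?_⟩
      rw [mul_assoc, ← pow_succ', pow_succ, ← mul_assoc, h, mul_assoc, of_mul_t, pow_succ,
        mul_assoc]
    · exact hof k hk y ih
  | mul_inv_cancel y hy s hs ih =>
    rcases hs with rfl | rfl
    · obtain ⟨i, j, l, hl, h⟩ := ih
      refine ⟨i, j + 1, l, hl, ?_⟩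
      rw [pow_succ', mul_assoc, inv_mul_cancel_left, h]
    · rw [← map_inv]
      exact hof k⁻¹ (inv_mem hk) y ih

theorem comap_of_closure {k : G} (h : SplitsOff φ k) :
    (Subgroup.closure {(t : DescHNN φ hφ), of k}).comap of = orbitSubgroup φ k := by
  apply le_antisymm
  · intro g hg
    obtain ⟨i, j, l, hl, hgl⟩ := exists_of_mem_closure (Subgroup.mem_comap.1 hg)
    have hij : j = i := by
      have := congrArg (degree φ hφ) hgl
      simpa [degree, ← ofAdd_nsmul] using this
    subst hij
    rw [of_mul_t_pow] at hgl
    have := of_injective _ (mul_left_cancel hgl)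
    exact h.mem_orbitSubgroup_of_iterate_mem hφ (this ▸ hl)
  · have hk : (of k : DescHNN φ hφ) ∈ Subgroup.closure {(t : DescHNN φ hφ), of k} :=
      Subgroup.subset_closure (by simp)
    have ht : (t : DescHNN φ hφ) ∈ Subgroup.closure {(t : DescHNN φ hφ), of k} :=
      Subgroup.subset_closure (by simp)
    refine iSup_le fun n => ?_
    induction n with
    | zero => exact bot_le
    | succ n ih =>
      refine sup_le (Subgroup.map_le_iff_le_comap.2 fun g hg => ?_) (Subgroup.zpowers_le.2 hk)
      have hgt : (of (φ g) : DescHNN φ hφ) = t⁻¹ * (of g * t) := by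
        rw [of_mul_t, inv_mul_cancel_left]
      rw [Subgroup.mem_comap, Subgroup.mem_comap, hgt]
      exact mul_mem (inv_mem ht) (mul_mem (ih hg) ht)

theorem not_howsonGroup_of_splitsOff [Group.FG G] {k : G} (hk : k ≠ 1) (h : SplitsOff φ k) :
    ¬ HowsonGroup (DescHNN φ hφ) := by
  intro hH
  have hbase : (of : G →* DescHNN φ hφ).range.FG := by
    rw [← Group.fg_iff_subgroup_fg]
    infer_instance
  have hfg := hH (Subgroup.closure {t, of k}) (of : G →* DescHNN φ hφ).range
    ((Subgroup.fg_iff _).2 ⟨_, rfl, Set.toFinite _⟩) hbase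
  rw [inf_comm, ← Subgroup.map_comap_eq, comap_of_closure h, ← Group.fg_iff_subgroup_fg] at hfg
  refine h.not_fg_orbitSubgroup hφ hk ?_
  rw [← Group.fg_iff_subgroup_fg]
  exact Group.fg_of_surjective
    (f := ((orbitSubgroup φ k).equivMapOfInjective (of : G →* DescHNN φ hφ)
      (of_injective _)).symm.toMonoidHom) (MulEquiv.surjective _)

end DescHNN

theorem IsInternalFreeProductPair.exists_splitsOff {G : Type*} [Group G] {A B : Subgroup G}
    (h : IsInternalFreeProductPair A B) (hgen : A ⊔ B = ⊤) (hB : B ≠ ⊥) {φ : G →* G}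
    (hAφ : A.map φ < A) (hBφ : B.map φ ≤ B) : ∃ k, k ≠ 1 ∧ SplitsOff φ k := by
  obtain ⟨a, ha, haφ⟩ := SetLike.exists_of_lt hAφ
  obtain ⟨b, hb, hb1⟩ := B.ne_bot_iff_exists_ne_one.1 hB |>.elim fun b hb =>
    (⟨b, b.2, fun h1 => hb (Subtype.ext h1)⟩ : ∃ b ∈ B, b ≠ 1)
  obtain ⟨Y, ρ, i, hi, hD, hk⟩ := h.exists_action hgen hAφ.le ha haφ hb
  have hrange : φ.range ≤ A.map φ ⊔ B := by
    rw [MonoidHom.range_eq_map, ← hgen, Subgroup.map_sup]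
    exact sup_le_sup_left hBφ _
  refine ⟨a * b * a⁻¹, by simpa using hb1, fun P hP x hx hxφ => ?_⟩
  exact mem_of_mem_sup_zpowers_of_action ρ hi hD hk (hP.trans hrange) hx (hrange hxφ)

/-- **Corollary.** Let a finitely generated group `G` be the free product of non-identity
subgroups `A` and `B` (the canonical map `A ∗ B → G` is injective with image all of `G`).
If `φ` is an injective but not surjective endomorphism of `G` with `Aφ ⊆ A` and `Bφ ⊆ B`,
then `G(φ)` does not have the Howson property. -/
theorem descHNN_of_free_product_not_howson {G : Type*} [Group G] [Group.FG G]
    (A B : Subgroup G) (hA : A ≠ ⊥) (hB : B ≠ ⊥)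
    (hfp : IsInternalFreeProductPair A B) (hgen : A ⊔ B = ⊤)
    (φ : G →* G) (hφ : Function.Injective φ) (hns : ¬ Function.Surjective φ)
    (hAφ : A.map φ ≤ A) (hBφ : B.map φ ≤ B) :
    ¬ HowsonGroup (DescHNN φ hφ) := by
  have hsplit : ∃ k, k ≠ 1 ∧ SplitsOff φ k := by
    rcases hAφ.lt_or_eq with hA' | hA'
    · exact hfp.exists_splitsOff hgen hB hA' hBφ
    · rcases hBφ.lt_or_eq with hB' | hB'
      · exact hfp.symm.exists_splitsOff (by rwa [sup_comm]) hA hB' hAφ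
      · refine absurd (MonoidHom.range_eq_top.1 ?_) hns
        rw [MonoidHom.range_eq_map, ← hgen, Subgroup.map_sup, hA', hB']
  obtain ⟨k, hk, h⟩ := hsplit
  exact DescHNN.not_howsonGroup_of_splitsOff hk h
end

section
/- Let G be a free abelian group of finite rank and let φ be an injective endomorphism of G whose matrix in some free basis of G is block-diagonal with at least two diagonal blocks of determinant different from ±1. Then the descending HNN-extension G(φ) = ⟨G, t ; t⁻¹gt = gφ (g ∈ G)⟩ does not have the Howson property. -/
theorem Subgroup.fg_map {G H : Type*} [Group G] [Group H] (f : G →* H) {P : Subgroup G}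
    (hP : P.FG) : (P.map f).FG := by
  classical
  obtain ⟨S, rfl⟩ := hP
  exact ⟨S.image f, by rw [Finset.coe_image, MonoidHom.map_closure]⟩

namespace DescHNN

variable {G : Type*} [Group G] {φ : G →* G} {hφ : Function.Injective φ}

/-- The canonical embedding of the base group. -/
noncomputable abbrev base (hφ : Function.Injective φ) : G →* DescHNN φ hφ := HNNExtension.of

/-- The stable letter. -/
noncomputable abbrev stable (hφ : Function.Injective φ) : DescHNN φ hφ := HNNExtension.t

theorem base_injective : Function.Injective (base hφ) :=
  HNNExtension.of_injective _

theorem base_mul_stable (g : G) :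
    base hφ g * stable hφ = stable hφ * base hφ (φ g) := by
  have h := HNNExtension.t_mul_of
    (φ := (MonoidHom.ofInjective hφ).symm.trans Subgroup.topEquiv.symm)
    (MonoidHom.ofInjective hφ g)
  rw [MulEquiv.trans_apply, MulEquiv.symm_apply_apply] at h
  exact h.symm

theorem base_mul_stable_pow (n : ℕ) (g : G) :
    base hφ g * stable hφ ^ n = stable hφ ^ n * base hφ (φ^[n] g) := by
  induction n generalizing g with
  | zero => simp
  | succ n ih =>
    rw [pow_succ', ← mul_assoc, base_mul_stable, mul_assoc, ih, ← mul_assoc,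
      Function.iterate_succ_apply]

theorem normalForm_shift (a b n : ℕ) (g : G) :
    stable hφ ^ a * base hφ g * (stable hφ ^ b)⁻¹ =
      stable hφ ^ (a + n) * base hφ (φ^[n] g) * (stable hφ ^ (b + n))⁻¹ := by
  rw [pow_add, pow_add, mul_inv_rev, mul_assoc (stable hφ ^ a) (stable hφ ^ n),
    ← base_mul_stable_pow]
  group

/-- The homomorphism to `ℤ` killing the base group and sending the stable letter to `1`. -/
noncomputable def exponent (hφ : Function.Injective φ) : DescHNN φ hφ →* Multiplicative ℤ :=
  HNNExtension.lift 1 (Multiplicative.ofAdd 1) (by simp)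

theorem exponent_normalForm (a b : ℕ) (g : G) :
    exponent hφ (stable hφ ^ a * base hφ g * (stable hφ ^ b)⁻¹) =
      Multiplicative.ofAdd ((a : ℤ) - b) := by
  simp [exponent, sub_eq_add_neg, ← ofAdd_nsmul]

theorem iterate_mem {P : Subgroup G} (hP : P ≤ P.comap φ) (n : ℕ) {g : G} (hg : g ∈ P) :
    φ^[n] g ∈ P := by
  induction n with
  | zero => exact hg
  | succ n ih => rw [Function.iterate_succ_apply']; exact hP ih

/-- The subgroup generated by a subgroup `P` of the base group and the stable letter. -/
noncomputable def extend (hφ : Function.Injective φ) (P : Subgroup G) : Subgroup (DescHNN φ hφ) :=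
  P.map (base hφ) ⊔ Subgroup.zpowers (stable hφ)

theorem stable_mem_extend (P : Subgroup G) : stable hφ ∈ extend hφ P :=
  Subgroup.mem_sup_right (Subgroup.mem_zpowers _)

theorem base_mem_extend {P : Subgroup G} {g : G} (hg : g ∈ P) : base hφ g ∈ extend hφ P :=
  Subgroup.mem_sup_left (Subgroup.mem_map_of_mem _ hg)

theorem extend_fg {P : Subgroup G} (hP : P.FG) : (extend hφ P).FG :=
  (Subgroup.fg_map _ hP).sup ⟨{stable hφ}, by simp [Subgroup.zpowers_eq_closure]⟩

theorem exists_normalForm {P : Subgroup G} (hP : P ≤ P.comap φ) {z : DescHNN φ hφ}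
    (hz : z ∈ extend hφ P) :
    ∃ a b : ℕ, ∃ g ∈ P, z = stable hφ ^ a * base hφ g * (stable hφ ^ b)⁻¹ := by
  let Q : Subgroup (DescHNN φ hφ) :=
    { carrier := {z | ∃ a b : ℕ, ∃ g ∈ P, z = stable hφ ^ a * base hφ g * (stable hφ ^ b)⁻¹}
      one_mem' := ⟨0, 0, 1, P.one_mem, by simp⟩
      mul_mem' := by
        rintro _ _ ⟨a, b, g, hg, rfl⟩ ⟨c, d, h, hh, rfl⟩
        refine ⟨a + c, d + b, φ^[c] g * φ^[b] h,
          P.mul_mem (iterate_mem hP c hg) (iterate_mem hP b hh), ?_⟩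
        rw [normalForm_shift a b c, normalForm_shift c d b, add_comm c b, map_mul]
        group
      inv_mem' := by
        rintro _ ⟨a, b, g, hg, rfl⟩
        exact ⟨b, a, g⁻¹, P.inv_mem hg, by simp [mul_assoc]⟩ }
  suffices extend hφ P ≤ Q from this hz
  refine sup_le ?_ ?_
  · rintro _ ⟨g, hg, rfl⟩
    exact ⟨0, 0, g, hg, by simp⟩
  · rw [Subgroup.zpowers_le]
    exact ⟨1, 0, 1, P.one_mem, by simp⟩

theorem exists_conj_of_mem_inf {G : Type*} [CommGroup G] {φ : G →* G}
    {hφ : Function.Injective φ} {P : Subgroup G} (hP : P ≤ P.comap φ) {y : G}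
    (hy : ∀ a b : ℕ, φ^[a] y / φ^[b] y ∈ P → a = b) {z : DescHNN φ hφ}
    (hz : z ∈ extend hφ P)
    (hz' : z ∈ (extend hφ P).map (MulAut.conj (base hφ y)).toMonoidHom) :
    ∃ n : ℕ, ∃ g ∈ P, z = stable hφ ^ n * base hφ g * (stable hφ ^ n)⁻¹ := by
  obtain ⟨w, hw, hwz⟩ := hz'
  obtain ⟨a, b, g, hg, rfl⟩ := exists_normalForm hP hz
  obtain ⟨c, d, h, hh, rfl⟩ := exists_normalForm hP hw
  have hexp := congrArg (exponent hφ) hwz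
  simp only [MulEquiv.toMonoidHom_eq_coe, MonoidHom.coe_coe, MulAut.conj_apply, map_mul,
    map_inv, mul_inv_cancel_comm] at hexp
  simp only [← map_mul, ← map_inv, exponent_normalForm] at hexp
  have hexp' : (c : ℤ) - d = a - b := Multiplicative.ofAdd.injective hexp
  have hac : d + a = b + c := by omega
  rw [normalForm_shift a b c, normalForm_shift c d a, hac, add_comm c a] at hwz
  have key : φ^[a + c] y * φ^[a] h = φ^[c] g * φ^[b + c] y := by
    apply base_injective (hφ := hφ)
    rw [map_mul, map_mul]
    refine mul_left_cancel (a := stable hφ ^ (a + c)) ?_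
    rw [← mul_assoc, ← base_mul_stable_pow]
    refine mul_right_cancel (b := (stable hφ ^ (b + c))⁻¹) ?_
    have h1 : base hφ (φ^[b + c] y) * (stable hφ ^ (b + c))⁻¹ =
        (stable hφ ^ (b + c))⁻¹ * base hφ y := by
      rw [mul_inv_eq_iff_eq_mul, mul_assoc, base_mul_stable_pow, inv_mul_cancel_left]
    rw [mul_assoc _ _ (_⁻¹), mul_assoc (_ ^ _), mul_assoc (base hφ (φ^[c] g)), h1]
    simp only [MulEquiv.toMonoidHom_eq_coe, MonoidHom.coe_coe, MulAut.conj_apply,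
      mul_inv_eq_iff_eq_mul] at hwz
    simpa only [mul_assoc] using hwz
  have hab : a + c = b + c := by
    apply hy
    have : φ^[a + c] y / φ^[b + c] y = φ^[c] g / φ^[a] h := by
      rw [div_eq_div_iff_mul_eq_mul, key]
    rw [this]
    exact P.div_mem (iterate_mem hP c hg) (iterate_mem hP a hh)
  obtain rfl : a = b := by omega
  exact ⟨a, g, hg, rfl⟩

/-- If a finitely generated subgroup `P` of an abelian group is mapped by `φ` properly into
itself, and the `φ`-orbit of some `y` is injective modulo `P`, then the descending
HNN-extension is not a Howson group. -/
theorem not_howson_of_orbit_injective_mod {G : Type*} [CommGroup G] {φ : G →* G}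
    {hφ : Function.Injective φ} {P : Subgroup G} (hPfg : P.FG) (hP : P ≤ P.comap φ)
    (hP' : ¬ P ≤ P.map φ) {y : G} (hy : ∀ a b : ℕ, φ^[a] y / φ^[b] y ∈ P → a = b) :
    ¬ HowsonGroup (DescHNN φ hφ) := by
  intro hH
  have hfg := hH _ _ (extend_fg (hφ := hφ) hPfg)
    (Subgroup.fg_map (MulAut.conj (base hφ y)).toMonoidHom (extend_fg hPfg))
  set I := extend hφ P ⊓ (extend hφ P).map (MulAut.conj (base hφ y)).toMonoidHom
  have mem_I (n : ℕ) {p : G} (hp : p ∈ P) :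
      stable hφ ^ n * base hφ p * (stable hφ ^ n)⁻¹ ∈ I := by
    have hmem : stable hφ ^ n * base hφ p * (stable hφ ^ n)⁻¹ ∈ extend hφ P :=
      mul_mem (mul_mem (pow_mem (stable_mem_extend P) n) (base_mem_extend hp))
        (inv_mem (pow_mem (stable_mem_extend P) n))
    refine ⟨hmem, _, hmem, ?_⟩
    simp only [MulEquiv.toMonoidHom_eq_coe, MonoidHom.coe_coe, MulAut.conj_apply]
    have hcomm : base hφ (φ^[n] y) * base hφ p = base hφ p * base hφ (φ^[n] y) := by
      rw [← map_mul, mul_comm, map_mul]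
    have hconj : base hφ (φ^[n] y) = (stable hφ ^ n)⁻¹ * base hφ y * stable hφ ^ n := by
      rw [mul_assoc, base_mul_stable_pow, inv_mul_cancel_left]
    rw [mul_inv_eq_iff_eq_mul, ← mul_assoc, ← mul_assoc, base_mul_stable_pow,
      mul_assoc (stable hφ ^ n), hcomm, hconj]
    group
  let C (n : ℕ) : Subgroup (DescHNN φ hφ) :=
    (P.map (base hφ)).map (MulAut.conj (stable hφ ^ n)).toMonoidHom
  have hmono : Monotone C := by
    refine monotone_nat_of_le_succ fun n => ?_
    rintro _ ⟨_, ⟨g, hg, rfl⟩, rfl⟩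
    refine ⟨_, ⟨φ g, hP hg, rfl⟩, ?_⟩
    exact (normalForm_shift n n 1 g).symm
  obtain ⟨S, hS⟩ := hfg
  have hSC (z : S) : ∃ n, (z : DescHNN φ hφ) ∈ C n := by
    have hz : (z : DescHNN φ hφ) ∈ I := hS ▸ Subgroup.subset_closure z.2
    obtain ⟨n, g, hg, h⟩ := exists_conj_of_mem_inf hP hy hz.1 hz.2
    exact ⟨n, _, ⟨g, hg, rfl⟩, h.symm⟩
  choose N hN using hSC
  obtain ⟨n, hn⟩ := Finite.exists_le N
  have hIC : I ≤ C n := by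
    rw [← hS, Subgroup.closure_le]
    exact fun z hz => hmono (hn ⟨z, hz⟩) (hN ⟨z, hz⟩)
  refine hP' fun p hp => ?_
  obtain ⟨_, ⟨g, hg, rfl⟩, h⟩ := hIC (mem_I (n + 1) hp)
  refine ⟨g, hg, base_injective (hφ := hφ) ?_⟩
  simp only [MulEquiv.toMonoidHom_eq_coe, MonoidHom.coe_coe, MulAut.conj_apply] at h
  rw [normalForm_shift n n 1 g] at h
  simpa using h

end DescHNN

/-- A square integer matrix whose determinant is not `±1` has a non-periodic vector. -/
theorem Matrix.exists_pow_mulVec_ne {n : Type*} [Fintype n] [DecidableEq n]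
    (M : Matrix n n ℤ) (h1 : M.det ≠ 1) (h2 : M.det ≠ -1) :
    ∃ y : n → ℤ, ∀ k : ℕ, 0 < k → (M ^ k).mulVec y ≠ y := by
  by_contra! h
  choose k hk0 hk using h
  have hmul (y : n → ℤ) (m : ℕ) : (M ^ (k y * m)).mulVec y = y := by
    induction m with
    | zero => simp
    | succ m ih => rw [mul_add_one, pow_add, ← Matrix.mulVec_mulVec, hk, ih]
  let N := ∏ c, k (Pi.single c 1)
  have hN : N ≠ 0 := Finset.prod_ne_zero_iff.2 fun c _ => (hk0 _).ne'
  have hone : M ^ N = 1 := by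
    refine Matrix.ext_of_mulVec_single fun c => ?_
    obtain ⟨m, hm⟩ := Finset.dvd_prod_of_mem (fun c => k (Pi.single c 1)) (Finset.mem_univ c)
    rw [show N = _ from hm, hmul, Matrix.one_mulVec]
  have hdet : M.det ^ N = 1 := by rw [← Matrix.det_pow, hone, Matrix.det_one]
  rcases Int.isUnit_iff.1 (IsUnit.of_pow_eq_one hdet hN) with h | h
  exacts [h1 h, h2 h]

/-- Let `G` be a free abelian group of finite rank and `φ` an injective endomorphism of
`G` whose matrix in some free basis is block-diagonal with at least two diagonal blocks of
determinant different from `±1`. Then `G(φ)` does not have the Howson property.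
Here the free abelian group with a block-decomposed basis is realized (multiplicatively)
as `Π i : Fin s, (Fin (d i) → ℤ)`, and `φ` acts on the `i`-th block by the integer matrix
`Bl i`. -/
theorem descHNN_of_free_abelian_blocks_not_howson (s : ℕ) (d : Fin s → ℕ)
    (Bl : ∀ i : Fin s, Matrix (Fin (d i)) (Fin (d i)) ℤ)
    (ψ : (∀ i : Fin s, Fin (d i) → ℤ) →+ (∀ i : Fin s, Fin (d i) → ℤ))
    (hψ : ∀ v i, ψ v i = (Bl i).mulVec (v i))
    (φ : Multiplicative (∀ i : Fin s, Fin (d i) → ℤ) →*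
      Multiplicative (∀ i : Fin s, Fin (d i) → ℤ))
    (hφψ : φ = AddMonoidHom.toMultiplicative ψ)
    (hφ : Function.Injective φ)
    (i j : Fin s) (hij : i ≠ j)
    (hi : (Bl i).det ≠ 1 ∧ (Bl i).det ≠ -1)
    (hj : (Bl j).det ≠ 1 ∧ (Bl j).det ≠ -1) :
    ¬ HowsonGroup (DescHNN φ hφ) := by
  have hψinj : Function.Injective ψ := by subst hφψ; exact hφ
  have hBinj : Function.Injective (Bl j).mulVec := by
    intro u v huv
    have : Pi.single (M := fun i => Fin (d i) → ℤ) j u = Pi.single j v := by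
      apply hψinj
      funext l
      rw [hψ, hψ]
      rcases eq_or_ne l j with rfl | hl
      · simpa using huv
      · simp [hl]
    exact Pi.single_injective j this
  obtain ⟨y, hy⟩ := (Bl j).exists_pow_mulVec_ne hj.1 hj.2
  have hiter (n : ℕ) (v : ∀ i : Fin s, Fin (d i) → ℤ) (l : Fin s) :
      Multiplicative.toAdd (φ^[n] (Multiplicative.ofAdd v)) l = (Bl l ^ n).mulVec (v l) := by
    induction n with
    | zero => simp
    | succ n ih =>
      rw [Function.iterate_succ_apply', pow_succ', ← Matrix.mulVec_mulVec, ← ih, ← hψ, hφψ]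
      rfl
  have hpow (a : ℕ) : Function.Injective (Bl j ^ a).mulVec := by
    induction a with
    | zero => intro u v h; simpa using h
    | succ a ih =>
      intro u v h
      rw [pow_succ, ← Matrix.mulVec_mulVec, ← Matrix.mulVec_mulVec] at h
      exact hBinj (ih h)
  have horbit (a b : ℕ) (h : (Bl j ^ a).mulVec y = (Bl j ^ b).mulVec y) (hab : a < b) :
      False := by
    obtain ⟨k, rfl⟩ := Nat.exists_eq_add_of_lt hab
    rw [add_assoc, pow_add, ← Matrix.mulVec_mulVec] at h
    exact hy (k + 1) k.succ_pos (hpow a h).symm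
  let P : Subgroup (Multiplicative (∀ i : Fin s, Fin (d i) → ℤ)) :=
    AddSubgroup.toSubgroup (AddMonoidHom.single (fun i => Fin (d i) → ℤ) i).range
  have hPmem (v : ∀ i : Fin s, Fin (d i) → ℤ) :
      Multiplicative.ofAdd v ∈ P ↔ ∃ u, Pi.single i u = v := Iff.rfl
  refine DescHNN.not_howson_of_orbit_injective_mod (P := P)
    (y := Multiplicative.ofAdd (Pi.single j y)) ?_ ?_ ?_ ?_
  · have : AddGroup.FG (Fin (d i) → ℤ) := Module.Finite.iff_addGroup_fg.1 inferInstance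
    exact (AddSubgroup.fg_iff_mul_fg _).1
      ((AddGroup.fg_iff_addSubgroup_fg _).1 (AddGroup.fg_range _))
  · rintro _ ⟨u, rfl⟩
    refine ⟨(Bl i).mulVec u, ?_⟩
    subst hφψ
    refine (funext fun l => ?_ : Pi.single i _ = ψ (Pi.single i u))
    rw [hψ]
    rcases eq_or_ne l i with rfl | hl
    · simp
    · simp [hl]
  · intro hle
    have hsurj : Function.Surjective (Bl i).mulVec := by
      intro u
      obtain ⟨_, ⟨w, rfl⟩, hw⟩ := hle ((hPmem (Pi.single i u)).2 ⟨u, rfl⟩)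
      subst hφψ
      have : ψ (Pi.single i w) = Pi.single i u := hw
      have := congrFun this i
      rw [hψ] at this
      exact ⟨w, by simpa using this⟩
    have := (Matrix.isUnit_iff_isUnit_det _).1 (Matrix.mulVec_surjective_iff_isUnit.1 hsurj)
    rcases Int.isUnit_iff.1 this with h | h
    exacts [hi.1 h, hi.2 h]
  · rintro a b ⟨u, hu⟩
    have h := congrFun hu j
    have h' : (0 : Fin (d j) → ℤ) = (Bl j ^ a).mulVec y - (Bl j ^ b).mulVec y := by
      have e1 := hiter a (Pi.single j y) j
      have e2 := hiter b (Pi.single j y) j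
      rw [Pi.single_eq_same] at e1 e2
      rw [← e1, ← e2]
      refine Eq.trans ?_ h
      simp [hij.symm]
    have h'' := sub_eq_zero.1 h'.symm
    rcases lt_trichotomy a b with hab | hab | hab
    · exact (horbit a b h'' hab).elim
    · exact hab
    · exact (horbit b a h''.symm hab).elim
end

section
/- If G is a non-cyclic finitely generated free group and φ is an injective but not surjective endomorphism of G, then the subgroup H = Gφ is freely complemented in G: there exists a non-identity subgroup K of G such that the subgroup generated by H and K is their internal free product H ∗ K. -/
namespace FreeGroup

variable {ι : Type*} [DecidableEq ι]

theorem toWord_mul_of_isReduced_append {x y : FreeGroup ι}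
    (h : IsReduced (x.toWord ++ y.toWord)) : (x * y).toWord = x.toWord ++ y.toWord := by
  rw [toWord_mul, h.reduce_eq]

/-- If `w` is not a prefix of `z`, then the reduced words of `w` and of `z⁻¹ * w` end with the
same letter. -/
theorem exists_last_of_not_prefix_toWord {w z : FreeGroup ι} (h : ¬ w.toWord <+: z.toWord) :
    ∃ l w₀ t₀, w.toWord = w₀ ++ [l] ∧ (z⁻¹ * w).toWord = t₀ ++ [l] := by
  have hred : ¬ IsReduced (w.toWord ++ (w⁻¹ * z).toWord) := by
    intro hr
    apply h
    have := toWord_mul_of_isReduced_append hr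
    rw [mul_inv_cancel_left] at this
    exact ⟨_, this.symm⟩
  rw [IsReduced, List.isChain_append] at hred
  have : ¬ ∀ x ∈ w.toWord.getLast?, ∀ y ∈ (w⁻¹ * z).toWord.head?, x.1 = y.1 → x.2 = y.2 :=
    fun hc => hred ⟨isReduced_toWord, isReduced_toWord, hc⟩
  push Not at this
  obtain ⟨l, hl, m, hm, h1, h2⟩ := this
  obtain ⟨w₀, hw₀⟩ : ∃ w₀, w.toWord = w₀ ++ [l] :=
    ⟨_, (List.dropLast_append_getLast? l hl).symm⟩
  obtain ⟨u₀, hu₀⟩ : ∃ u₀, (w⁻¹ * z).toWord = m :: u₀ := ⟨_, List.eq_cons_of_mem_head? hm⟩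
  refine ⟨l, w₀, invRev u₀, hw₀, ?_⟩
  have hinv : z⁻¹ * w = (w⁻¹ * z)⁻¹ := by group
  rw [hinv, toWord_inv, hu₀]
  have hlm : (m.1, !m.2) = l := by
    ext
    · exact h1.symm
    · cases hm2 : m.2 <;> cases hl2 : l.2 <;> simp_all
  simp [invRev, hlm]

/-- Geodesic triangles in the Cayley tree are tripods: a point of the geodesic from `1` to `y`
that is not on the geodesic from `1` to `z` is on the geodesic from `z` to `y`. -/
theorem inv_mul_prefix_of_not_prefix_toWord {w y z : FreeGroup ι} (hy : w.toWord <+: y.toWord)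
    (hz : ¬ w.toWord <+: z.toWord) : (z⁻¹ * w).toWord <+: (z⁻¹ * y).toWord := by
  obtain ⟨l, w₀, t₀, hw, ht⟩ := exists_last_of_not_prefix_toWord hz
  obtain ⟨v, hv⟩ := hy
  have hvy : y = w * mk v := by rw [← mk_toWord (x := y), ← hv, ← mul_mk, mk_toWord]
  have hyr : IsReduced (w.toWord ++ v) := hv ▸ isReduced_toWord
  have hvr : (mk v).toWord = v := by
    rw [toWord_mk]
    exact IsReduced.reduce_eq (hyr.right_of_append)
  have hr : IsReduced ((z⁻¹ * w).toWord ++ (mk v).toWord) := by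
    rw [hvr, ht]
    refine IsReduced.append_overlap (ht ▸ isReduced_toWord) ?_ (by simp)
    rw [hw, List.append_assoc] at hyr
    exact hyr.right_of_append
  have := toWord_mul_of_isReduced_append hr
  rw [mul_assoc, ← hvy] at this
  exact ⟨_, this.symm⟩

theorem norm_le_of_prefix_toWord {x y : FreeGroup ι} (h : x.toWord <+: y.toWord) : x.norm ≤ y.norm :=
  h.length_le

theorem fst_eq_of_mem_toWord_of_zpow {b : ι} {n : ℤ} {p : ι × Bool}
    (hp : p ∈ (of b ^ n).toWord) : p.1 = b := by
  obtain ⟨k, rfl | rfl⟩ := n.eq_nat_or_neg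
  · rw [zpow_natCast, toWord_of_pow] at hp
    rw [List.eq_of_mem_replicate hp]
  · rw [zpow_neg, zpow_natCast, toWord_inv, toWord_of_pow] at hp
    simp only [invRev, List.map_replicate, List.reverse_replicate] at hp
    rw [List.eq_of_mem_replicate hp]

theorem of_zpow_ne_one (b : ι) {n : ℤ} (hn : n ≠ 0) : of b ^ n ≠ 1 := by
  obtain ⟨k, rfl | rfl⟩ := n.eq_nat_or_neg
  · intro h
    have := norm_of_pow b k
    rw [zpow_natCast] at h
    rw [h, norm_one] at this
    simp_all
  · intro h
    have := norm_of_pow b k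
    rw [zpow_neg, zpow_natCast, inv_eq_one] at h
    rw [h, norm_one] at this
    simp_all

/-- If the last letter of `w` does not involve the generator `b`, then the nontrivial powers of
`w * of b * w⁻¹` map the complement of the cone at `w` into that cone. -/
theorem prefix_conj_zpow_mul {w : FreeGroup ι} {w₀ : List (ι × Bool)} {l : ι × Bool}
    (hw : w.toWord = w₀ ++ [l]) {b : ι} (hb : b ≠ l.1) {n : ℤ} (hn : n ≠ 0) {y : FreeGroup ι}
    (hy : ¬ w.toWord <+: y.toWord) :
    w.toWord <+: ((w * of b * w⁻¹) ^ n * y).toWord := by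
  obtain ⟨l', w₁, t₀, hw', ht⟩ := exists_last_of_not_prefix_toWord hy
  obtain rfl : l = l' := by
    have := congrArg List.getLast? (hw.symm.trans hw')
    simpa using this
  have hu : (w⁻¹ * y).toWord = (l.1, !l.2) :: invRev t₀ := by
    have hinv : w⁻¹ * y = (y⁻¹ * w)⁻¹ := by group
    rw [hinv, toWord_inv, ht]
    simp [invRev]
  have hne : (of b ^ n).toWord ≠ [] := fun h => of_zpow_ne_one b hn (toWord_eq_nil_iff.mp h)
  have h1 : IsReduced (w.toWord ++ (of b ^ n).toWord) := by
    rw [IsReduced, List.isChain_append]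
    refine ⟨isReduced_toWord, isReduced_toWord, fun p hp q hq hpq => absurd ?_ hb⟩
    have hpl : p = l := by rw [hw] at hp; simpa using hp.symm
    rw [← hpl, hpq, fst_eq_of_mem_toWord_of_zpow (List.mem_of_mem_head? hq)]
  have h2 : IsReduced ((of b ^ n).toWord ++ (w⁻¹ * y).toWord) := by
    rw [IsReduced, List.isChain_append]
    refine ⟨isReduced_toWord, isReduced_toWord, fun p hp q hq hpq => absurd ?_ hb⟩
    have hql : q = (l.1, !l.2) := by rw [hu] at hq; simpa using hq.symm
    rw [← fst_eq_of_mem_toWord_of_zpow (List.mem_of_mem_getLast? hp), hpq, hql]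
  have h3 := h1.append_overlap h2 hne
  rw [← toWord_mul_of_isReduced_append h1] at h3
  have h4 := toWord_mul_of_isReduced_append h3
  rw [toWord_mul_of_isReduced_append h1, List.append_assoc] at h4
  have h5 : (w * of b * w⁻¹) ^ n * y = w * of b ^ n * (w⁻¹ * y) := by
    rw [conj_zpow]; group
  rw [h5]
  exact ⟨_, h4.symm⟩

/-- If no point of the coset `H * w` is within distance `R` of `H`, where `H` is generated by
elements of length at most `R`, then the cone at `w` contains no element of `H`. -/
theorem not_prefix_of_mem_closure {S : Set (FreeGroup ι)} {R : ℕ} (hS : ∀ s ∈ S, s.norm ≤ R)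
    {w : FreeGroup ι}
    (hw : ∀ h ∈ Subgroup.closure S, ∀ x : FreeGroup ι, x.norm ≤ R → w ≠ h * x)
    {h : FreeGroup ι} (hh : h ∈ Subgroup.closure S) : ¬ w.toWord <+: h.toWord := by
  have key : ∀ x ∈ Subgroup.closure S, ∀ s, s.norm ≤ R → s ∈ Subgroup.closure S →
      w.toWord <+: (x * s).toWord → w.toWord <+: x.toWord := by
    intro x hx s hs hsm hp
    by_contra hc
    have h1 := norm_le_of_prefix_toWord (inv_mul_prefix_of_not_prefix_toWord hp hc)
    rw [inv_mul_cancel_left] at h1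
    exact hw x hx (x⁻¹ * w) (h1.trans hs) (by group)
  induction hh using Subgroup.closure_induction_right with
  | one =>
    intro hp
    rw [toWord_one, List.prefix_nil, toWord_eq_nil_iff] at hp
    exact hw 1 (one_mem _) 1 (by simp) (by simp [hp])
  | mul_right x hx y hy ih =>
    exact fun hp => ih (key x hx y (hS y hy) (Subgroup.subset_closure hy) hp)
  | mul_inv_cancel x hx y hy ih =>
    exact fun hp => ih (key x hx y⁻¹ (by simpa using hS y hy)
      (inv_mem (Subgroup.subset_closure hy)) hp)

theorem finite_setOf_norm_le [Finite ι] (R : ℕ) : {x : FreeGroup ι | x.norm ≤ R}.Finite :=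
  Set.Finite.of_finite_image ((List.finite_length_le (ι × Bool) R).subset
    (by rintro _ ⟨x, hx, rfl⟩; exact hx)) toWord_injective.injOn

/-- A finitely generated subgroup of infinite index in a free group of finite rank has a cone
disjoint from all its translates by nontrivial elements of the subgroup. -/
theorem exists_cone_disjoint_translates [Finite ι] {H : Subgroup (FreeGroup ι)} (hfg : H.FG)
    (hH : ¬ H.FiniteIndex) :
    ∃ w : FreeGroup ι, w ≠ 1 ∧ ∀ h ∈ H, h ≠ 1 → ∀ y : FreeGroup ι, w.toWord <+: y.toWord →
      ¬ w.toWord <+: (h * y).toWord := by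
  obtain ⟨S, rfl⟩ := hfg
  obtain ⟨R, hR⟩ : ∃ R : ℕ, ∀ s ∈ S, s.norm ≤ R := ⟨S.sup norm, fun s hs => S.le_sup hs⟩
  set H := Subgroup.closure (S : Set (FreeGroup ι)) with hHdef
  obtain ⟨w₁, hw₁⟩ : ∃ w₁, ∀ h ∈ H, ∀ x : FreeGroup ι, x.norm ≤ R → w₁ ≠ h * x := by
    by_contra! hc
    apply hH
    have hfin : Set.Finite (Set.univ : Set (FreeGroup ι ⧸ H)) := by
      refine ((finite_setOf_norm_le R).image
        fun x => ((x⁻¹ : FreeGroup ι) : FreeGroup ι ⧸ H)).subset ?_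
      rintro ⟨g⟩ -
      obtain ⟨h, hh, x, hx, hg⟩ := hc g⁻¹
      refine ⟨x, hx, ?_⟩
      refine QuotientGroup.eq.mpr ?_
      have : x⁻¹⁻¹ * g = h⁻¹ := by
        rw [← inv_inj, mul_inv_rev, hg]; group
      rw [this]
      exact inv_mem hh
    have : Finite (FreeGroup ι ⧸ H) := Set.finite_univ_iff.mp hfin
    exact Subgroup.finiteIndex_of_finite_quotient
  let T : Set (FreeGroup ι) := {w | ∃ h ∈ H, w = h * w₁}
  obtain ⟨w, ⟨h₀, hh₀, hw₀⟩, hmin⟩ : ∃ w ∈ T, ∀ w' ∈ T, w.norm ≤ w'.norm := by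
    have hT : T.Nonempty := ⟨w₁, 1, one_mem _, by simp⟩
    exact ⟨_, Function.argminOn_mem norm T hT,
      fun w' hw' => Function.argminOn_le norm T hw'⟩
  have hw : ∀ h ∈ H, ∀ x : FreeGroup ι, x.norm ≤ R → w ≠ h * x := by
    intro h hh x hx he
    refine hw₁ (h₀⁻¹ * h) (mul_mem (inv_mem hh₀) hh) x hx ?_
    rw [mul_assoc, ← he, hw₀]; group
  have hmin' : ∀ h ∈ H, w.norm ≤ (h * w).norm := fun h hh =>
    hmin _ ⟨h * h₀, mul_mem hh hh₀, by rw [hw₀, mul_assoc]⟩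
  have hcone : ∀ h ∈ H, ¬ w.toWord <+: h.toWord := fun h hh =>
    not_prefix_of_mem_closure hR hw hh
  have heq_one : ∀ h ∈ H, (h * w).toWord <+: w.toWord → h = 1 := by
    intro h hh hp
    have := toWord_injective (hp.eq_of_length_le (hmin' h hh))
    simpa using this
  refine ⟨w, ?_, ?_⟩
  · rintro rfl
    exact hcone 1 (one_mem _) List.prefix_rfl
  · intro h hh hne y hy hhy
    have h1 : (h * w).toWord <+: (h * y).toWord := by
      simpa using inv_mul_prefix_of_not_prefix_toWord hy (hcone h⁻¹ (inv_mem hh))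
    rcases List.prefix_or_prefix_of_prefix h1 hhy with h2 | h2
    · exact hne (heq_one h hh h2)
    · have h3 := inv_mul_prefix_of_not_prefix_toWord h2 (hcone h hh)
      rw [inv_mul_cancel_left] at h3
      exact hne (inv_eq_one.mp (heq_one h⁻¹ (inv_mem hh) h3))

end FreeGroup

open Monoid in
/-- Injectivity of the map from the binary free product of two subgroups follows from that of the
map from the free product indexed by `Bool`. -/
theorem Monoid.Coprod.lift_injective_of_coprodI {G : Type*} [Group G] (H K : Subgroup G)
    (h : Function.Injective (CoprodI.lift fun i : Bool => (cond i H K).subtype)) :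
    Function.Injective (Coprod.lift H.subtype K.subtype) := by
  let f : Coprod H K →* CoprodI fun i : Bool => (cond i H K : Subgroup G) :=
    Coprod.lift (CoprodI.of (M := fun i : Bool => (cond i H K : Subgroup G)) (i := true))
      (CoprodI.of (M := fun i : Bool => (cond i H K : Subgroup G)) (i := false))
  let f' : (CoprodI fun i : Bool => (cond i H K : Subgroup G)) →* Coprod H K :=
    CoprodI.lift fun i => match i with
      | true => Coprod.inl
      | false => Coprod.inr
  have hf : f'.comp f = .id _ := by
    apply Coprod.hom_ext <;> ext x <;> simp [f, f', -CoprodI.lift_comp_of]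
  have hc : (CoprodI.lift fun i : Bool => (cond i H K).subtype).comp f
      = Coprod.lift H.subtype K.subtype := by
    apply Coprod.hom_ext <;> ext x <;> simp [f]
  rw [← hc]
  exact h.comp (Function.LeftInverse.injective (g := f') (DFunLike.congr_fun hf))

/-- Ping-pong for a subgroup `H` and the cyclic subgroup generated by `g`. -/
theorem isInternalFreeProductPair_zpowers_of_ping_pong {G α : Type*} [Group G] [MulAction G α]
    (H : Subgroup G) (g : G) (U : Set α) (hU : U.Nonempty) (hUc : Uᶜ.Nonempty)
    (hH : ∀ h ∈ H, h ≠ 1 → ∀ y ∈ U, h • y ∉ U)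
    (hg : ∀ n : ℤ, n ≠ 0 → ∀ y ∉ U, g ^ n • y ∈ U) :
    Subgroup.zpowers g ≠ ⊥ ∧ IsInternalFreeProductPair H (Subgroup.zpowers g) := by
  have hg1 : ∀ n : ℤ, n ≠ 0 → g ^ n ≠ 1 := by
    intro n hn h1
    obtain ⟨y, hy⟩ := hUc
    have := hg n hn y hy
    rw [h1, one_smul] at this
    exact hy this
  have hinf : Infinite (Subgroup.zpowers g) := by
    refine Set.infinite_coe_iff.mpr (infinite_zpowers.mpr fun hfin => ?_)
    obtain ⟨n, hn, h1⟩ := isOfFinOrder_iff_pow_eq_one.mp hfin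
    exact hg1 n (by omega) (by simpa using h1)
  refine ⟨?_, Monoid.Coprod.lift_injective_of_coprodI H _ ?_⟩
  · rw [Ne, Subgroup.zpowers_eq_bot]
    simpa using hg1 1 one_ne_zero
  refine Monoid.CoprodI.lift_injective_of_ping_pong _ (.inr ⟨false, ?_⟩)
    (fun i => cond i Uᶜ U) ?_ ?_ ?_
  · have : Infinite (cond false H (Subgroup.zpowers g) : Subgroup G) := hinf
    exact ((Cardinal.natCast_lt_aleph0 (n := 3)).le).trans (Cardinal.aleph0_le_mk _)
  · rintro (_ | _)
    exacts [hU, hUc]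
  · rintro (_ | _) (_ | _) hij
    exacts [absurd rfl hij, disjoint_compl_right, disjoint_compl_left, absurd rfl hij]
  · rintro (_ | _) (_ | _) hij ⟨k, hk⟩ hne
    · exact absurd rfl hij
    · rintro _ ⟨y, hy, rfl⟩
      obtain ⟨n, rfl⟩ := Subgroup.mem_zpowers_iff.mp hk
      refine hg n ?_ y hy
      rintro rfl
      exact hne (Subtype.ext (zpow_zero g))
    · rintro _ ⟨y, hy, rfl⟩
      exact hH k hk (fun h => hne (Subtype.ext h)) y hy
    · exact absurd rfl hij

/-- A free group of rank `n ≥ 2` has no proper subgroup of finite index generated by `n`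
elements. -/
theorem FreeGroup.surjective_of_finiteIndex_range {ι : Type*} [Finite ι] [Nontrivial ι]
    (φ : FreeGroup ι →* FreeGroup ι) (hfin : φ.range.FiniteIndex) :
    Function.Surjective φ := by
  rw [← MonoidHom.range_eq_top]
  set H := φ.range with hH
  let X := FreeGroup ι ⧸ H
  have : Finite X := Subgroup.finite_quotient_of_finiteIndex
  let A := Multiplicative (ZMod 2)
  let x₀ : X := ((1 : FreeGroup ι) : X)
  let c (f : ι → X → A) : FreeGroup ι →* (X → A) ⋊[mulAutArrow] FreeGroup ι :=
    FreeGroup.lift fun i => ⟨f i, FreeGroup.of i⟩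
  have hcr (f) (g) : (c f g).right = g := by
    have : (SemidirectProduct.rightHom).comp (c f) = .id _ := by
      ext i; simp [c]
    exact DFunLike.congr_fun this g
  have hcm (f) (g h : FreeGroup ι) (x : X) :
      (c f (g * h)).left x = (c f g).left x * (c f h).left (g⁻¹ • x) := by
    rw [_root_.map_mul, SemidirectProduct.mul_left, hcr]
    rfl
  have hfix (g : FreeGroup ι) (hg : g ∈ H) : g • x₀ = x₀ := by
    refine QuotientGroup.eq.mpr ?_
    simpa using hg
  have hφfix (g : FreeGroup ι) : (φ g)⁻¹ • x₀ = x₀ := hfix _ (inv_mem ⟨g, rfl⟩)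
  let d (f : ι → X → A) : FreeGroup ι →* A := MonoidHom.mk' (fun g => (c f (φ g)).left x₀) (by
    intro g h
    rw [_root_.map_mul, hcm, hφfix])
  let s (x : X) : FreeGroup ι := Quotient.out x
  have hs (x : X) : s x • x₀ = x := by
    conv_rhs => rw [← QuotientGroup.out_eq' x]
    change ((s x * 1 : FreeGroup ι) : X) = _
    rw [mul_one]
  let Ψ (f : ι → X → A) : (ι → A) × ({x : X // x ≠ x₀} → A) :=
    (fun i => d f (FreeGroup.of i), fun x => (c f (s x)).left x)
  have hΨ : Function.Injective Ψ := by
    intro f f' hff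
    have hd : d f = d f' := by
      ext i
      exact congrArg _ (congrFun (congrArg Prod.fst hff) i)
    have hH' (g : FreeGroup ι) (hg : g ∈ H) : (c f g).left x₀ = (c f' g).left x₀ := by
      obtain ⟨g, rfl⟩ := hg
      exact DFunLike.congr_fun hd g
    have hs' (x : X) : (c f (s x)).left x = (c f' (s x)).left x := by
      by_cases hx : x = x₀
      · rw [hx]
        refine hH' _ ?_
        have := hs x₀
        have := QuotientGroup.eq.mp (show ((s x₀ * 1 : FreeGroup ι) : X) = ((1 : FreeGroup ι) : X)
          from this)
        simpa using this
      · exact congrFun (congrArg Prod.snd hff) ⟨x, hx⟩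
    have hsinv (f) (x : X) : (c f (s x)⁻¹).left x₀ = ((c f (s x)).left x)⁻¹ := by
      have h1 := hcm f (s x)⁻¹ (s x) x₀
      rw [inv_mul_cancel, _root_.map_one, inv_inv, hs] at h1
      exact eq_inv_of_mul_eq_one_left h1.symm
    have hall (g : FreeGroup ι) (x : X) : (c f g).left x = (c f' g).left x := by
      set y := g⁻¹ • x with hy
      have hsx (z : X) : (s z)⁻¹ • z = x₀ := by rw [inv_smul_eq_iff, hs]
      have hmem : (s x)⁻¹ * g * s y ∈ H := by
        have h1 : ((s x)⁻¹ * g * s y) • x₀ = x₀ := by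
          rw [mul_smul, hs, mul_smul, hy, smul_inv_smul, hsx]
        have := QuotientGroup.eq.mp (show (((s x)⁻¹ * g * s y * 1 : FreeGroup ι) : X)
          = ((1 : FreeGroup ι) : X) from h1)
        simpa [mul_assoc] using inv_mem this
      have hg : g = s x * (((s x)⁻¹ * g * s y) * (s y)⁻¹) := by group
      have hexp (f) : (c f g).left x = (c f (s x)).left x *
          ((c f ((s x)⁻¹ * g * s y)).left x₀ * ((c f (s y)).left y)⁻¹) := by
        conv_lhs => rw [hg]
        rw [hcm, hsx, hcm, hfix _ (inv_mem hmem), hsinv]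
      rw [hexp f, hexp f', hs', hs', hH' _ hmem]
    funext i x
    have := hall (FreeGroup.of i) x
    simpa [c] using this
  have hcard := Nat.card_le_card_of_injective Ψ hΨ
  have := Fintype.ofFinite X
  have := Fintype.ofFinite ι
  classical
  have hA : Fintype.card A = 2 := rfl
  rw [Nat.card_eq_fintype_card, Nat.card_eq_fintype_card] at hcard
  simp only [Fintype.card_prod, Fintype.card_fun, hA, Fintype.card_subtype_compl,
    Fintype.card_unique, ← pow_mul, ← pow_add] at hcard
  have h2 := (Nat.pow_le_pow_iff_right (by norm_num)).mp hcard
  have hι : 2 ≤ Fintype.card ι := Fintype.one_lt_card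
  have hX : 1 ≤ Fintype.card X := Fintype.card_pos_iff.mpr ⟨x₀⟩
  have hX1 : Fintype.card X = 1 := by
    obtain ⟨m, hm⟩ := Nat.exists_eq_add_of_le hX
    obtain ⟨n, hn⟩ := Nat.exists_eq_add_of_le hι
    simp only [hm, hn] at h2
    have : m = 0 := by
      by_contra h0
      have : 1 ≤ m := Nat.one_le_iff_ne_zero.mpr h0
      have h3 : 1 + m - 1 = m := by omega
      rw [h3] at h2
      nlinarith
    omega
  rw [← Subgroup.index_eq_one, Subgroup.index_eq_card, Nat.card_eq_fintype_card]
  exact hX1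

theorem FreeGroup.finite_of_fg {ι : Type*} [Group.FG (FreeGroup ι)] : Finite ι := by
  classical
  obtain ⟨α, _, π, hπ⟩ := Group.fg_iff_exists_freeGroup_hom_surjective_finite.mp
    (inferInstance : Group.FG (FreeGroup ι))
  let A := Multiplicative (ZMod 2)
  have : Finite (FreeGroup ι →* A) := by
    refine Finite.of_injective
      (fun f : FreeGroup ι →* A => FreeGroup.lift.symm (f.comp π)) fun f f' h => ?_
    exact (MonoidHom.cancel_right hπ).mp (FreeGroup.lift.symm.injective h)
  have : Finite (ι → A) := Finite.of_equiv _ FreeGroup.lift.symm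
  refine Finite.of_injective (fun i : ι => (Pi.mulSingle i (Multiplicative.ofAdd 1) : ι → A)) ?_
  intro i j h
  by_contra hij
  have := congrFun h i
  simp only [Pi.mulSingle_eq_same, Pi.mulSingle_eq_of_ne hij] at this
  exact absurd this (by decide)

theorem FreeGroup.isCyclic_of_subsingleton {ι : Type*} [Subsingleton ι] :
    IsCyclic (FreeGroup ι) := by
  cases isEmpty_or_nonempty ι
  · infer_instance
  · have := (nonempty_unique ι).some
    infer_instance

/-- If `G` is a non-cyclic finitely generated free group and `φ` is an injective but not
surjective endomorphism of `G`, then the subgroup `H = Gφ` is freely complemented in `G`: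
there is a non-identity subgroup `K` of `G` such that the subgroup generated by `H` and
`K` is their internal free product `H ∗ K`. -/
theorem range_freelyComplemented_of_free {G : Type*} [Group G] [IsFreeGroup G] [Group.FG G]
    (hnc : ¬ IsCyclic G) (φ : G →* G) (hφ : Function.Injective φ)
    (hns : ¬ Function.Surjective φ) :
    ∃ K : Subgroup G, K ≠ ⊥ ∧ IsInternalFreeProductPair (MonoidHom.range φ) K := by
  classical
  let e := IsFreeGroup.mulEquiv G
  have : Group.FG (FreeGroup (IsFreeGroup.Generators G)) :=
    Group.fg_of_surjective (f := e.symm.toMonoidHom) e.symm.surjective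
  have : Finite (IsFreeGroup.Generators G) := FreeGroup.finite_of_fg
  have : Nontrivial (IsFreeGroup.Generators G) := by
    by_contra hn
    rw [not_nontrivial_iff_subsingleton] at hn
    have := FreeGroup.isCyclic_of_subsingleton (ι := IsFreeGroup.Generators G)
    exact hnc (isCyclic_of_surjective e e.surjective)
  let ψ := e.symm.toMonoidHom.comp (φ.comp e.toMonoidHom)
  have hψ (g : G) : e.symm (φ g) = ψ (e.symm g) := by simp [ψ]
  have hfin : ¬ ψ.range.FiniteIndex := by
    intro h
    have hs := FreeGroup.surjective_of_finiteIndex_range ψ h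
    refine hns fun g => ?_
    obtain ⟨x, hx⟩ := hs (e.symm g)
    exact ⟨e x, e.symm.injective hx⟩
  obtain ⟨w, hw1, hw⟩ := FreeGroup.exists_cone_disjoint_translates
    (Group.fg_iff_subgroup_fg _ |>.mp (Group.fg_range ψ)) hfin
  obtain ⟨w₀, l, hwl⟩ : ∃ w₀ l, w.toWord = w₀ ++ [l] :=
    (List.eq_nil_or_concat' w.toWord).resolve_left fun h => hw1 (FreeGroup.toWord_eq_nil_iff.mp h)
  obtain ⟨b, hb⟩ := exists_ne l.1
  let _ : MulAction G (FreeGroup (IsFreeGroup.Generators G)) :=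
    MulAction.compHom _ e.symm.toMonoidHom
  refine ⟨_, isInternalFreeProductPair_zpowers_of_ping_pong φ.range
    (e (w * FreeGroup.of b * w⁻¹)) {y | w.toWord <+: y.toWord} ⟨w, ?_⟩ ⟨1, ?_⟩ ?_ ?_⟩
  · exact List.prefix_rfl
  · simpa using hw1
  · rintro _ ⟨g, rfl⟩ hne y hy
    refine hw (e.symm (φ g)) ⟨e.symm g, (hψ g).symm⟩ ?_ y hy
    simpa using hne
  · intro n hn y hy
    have hsmul : e (w * FreeGroup.of b * w⁻¹) ^ n • y = (w * FreeGroup.of b * w⁻¹) ^ n * y := by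
      change e.symm (e (w * FreeGroup.of b * w⁻¹) ^ n) * y = _
      rw [← map_zpow, e.symm_apply_apply]
    rw [hsmul]
    exact FreeGroup.prefix_conj_zpow_mul hwl hb hn hy
end
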